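/- There exists a universal constant c > 0 such that for every auction representation language L, every integer m ≥ 1, and every real H with 2 ≤ H < 2^{m/400}, there exists a finitely supported probability distribution D on [1, H]^m such that every menu M whose L-complexity is at most 2^{m/400} satisfies Rev_D(M) ≤ c · OPT(D) / log₂ H. -/

import Mathlib

open MeasureTheory

/-- An entry of a menu: a lottery (vector of allocation probabilities) together with a price. -/
abbrev Entry (m : ℕ) := (Fin m → ℝ) × ℝ

/-- A lottery: nonnegative coordinates summing to at most 1. -/
def IsLottery (m : ℕ) (x : Fin m → ℝ) : Prop := (∀ j, 0 ≤ x j) ∧ ∑ j, x j ≤ 1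

/-- A menu: a finite set of entries containing the null entry `(0, 0)`,
all of whose entries are lotteries. -/
def IsMenu (m : ℕ) (M : Finset (Entry m)) : Prop :=
  (0, 0) ∈ M ∧ ∀ e ∈ M, IsLottery m e.1

/-- Utility of entry `e` for a buyer with valuation `v`. -/
def utility {m : ℕ} (v : Fin m → ℝ) (e : Entry m) : ℝ := (∑ j, v j * e.1 j) - e.2

/-- A selection rule for menu `M`: picks, for each valuation, a utility-maximizing entry of `M`. -/
def IsSelection {m : ℕ} (M : Finset (Entry m)) (s : (Fin m → ℝ) → Entry m) : Prop :=
  ∀ v, s v ∈ M ∧ ∀ e ∈ M, utility v e ≤ utility v (s v)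

/-- Revenue of a selection rule `s` under distribution `D`: expected price paid. -/
noncomputable def revSel {m : ℕ} (D : Measure (Fin m → ℝ))
    (s : (Fin m → ℝ) → Entry m) : ℝ :=
  ∫ v, (s v).2 ∂D

/-- Revenue of menu `M` under distribution `D`: supremum over selection rules. -/
noncomputable def Rev {m : ℕ} (D : Measure (Fin m → ℝ)) (M : Finset (Entry m)) : ℝ :=
  sSup {r | ∃ s, IsSelection M s ∧ r = revSel D s}

/-- Optimal revenue for a distribution `D`: supremum over all menus. -/
noncomputable def OPT {m : ℕ} (D : Measure (Fin m → ℝ)) : ℝ :=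
  sSup {r | ∃ M : Finset (Entry m), IsMenu m M ∧ r = Rev D M}

/-- Best nonnegative-price entry. -/
lemma exists_best {m : ℕ} (M : Finset (Entry m)) (hM : IsMenu m M) (v : Fin m → ℝ) :
    ∃ e ∈ M, 0 ≤ e.2 ∧ (∀ e' ∈ M, 0 ≤ e'.2 → utility v e' ≤ utility v e) ∧
      ∀ e' ∈ M, (∀ e'' ∈ M, utility v e'' ≤ utility v e') → e'.2 ≤ e.2 := by
  classical
  obtain ⟨e0, he0, h0⟩ := Finset.exists_max_image (M.filter (fun e => 0 ≤ e.2)) (utility v)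
    ⟨(0, 0), by simp [hM.1]⟩
  obtain ⟨e, he, h⟩ := Finset.exists_max_image
    ((M.filter (fun e => 0 ≤ e.2)).filter (fun e => utility v e0 ≤ utility v e)) (fun e => e.2)
    ⟨e0, by rw [Finset.mem_filter]; exact ⟨he0, le_rfl⟩⟩
  simp only [Finset.mem_filter] at he0 h0 he h
  refine ⟨e, he.1.1, he.1.2, fun e' h1 h2 => (h0 e' ⟨h1, h2⟩).trans he.2, fun e' h1 h2 => ?_⟩
  by_cases hn : 0 ≤ e'.2
  · exact h e' ⟨⟨h1, hn⟩, h2 _ he0.1⟩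
  · exact (not_le.mp hn).le.trans he.1.2

/-- Valuation: `2^k` on `A`, `1` elsewhere. -/
noncomputable def val {m : ℕ} (A : Finset (Fin m)) (k : ℕ) : Fin m → ℝ :=
  fun j => if j ∈ A then 2 ^ k else 1

lemma utility_val {m : ℕ} (A : Finset (Fin m)) (k : ℕ) (e : Entry m) :
    utility (val A k) e = (∑ j, e.1 j - ∑ j ∈ A, e.1 j) + 2 ^ k * ∑ j ∈ A, e.1 j - e.2 := by
  unfold utility val
  have : ∀ j, (if j ∈ A then (2:ℝ) ^ k else 1) * e.1 j
      = e.1 j + (if j ∈ A then ((2:ℝ) ^ k - 1) * e.1 j else 0) := by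
    intro j; split_ifs <;> ring
  simp_rw [this]
  rw [Finset.sum_add_distrib, Finset.sum_ite_mem, Finset.univ_inter, ← Finset.mul_sum]
  ring

lemma lottery_sub {m : ℕ} {x : Fin m → ℝ} (hx : IsLottery m x) (A : Finset (Fin m)) :
    0 ≤ ∑ j ∈ A, x j ∧ ∑ j ∈ A, x j ≤ ∑ j, x j ∧ ∑ j, x j ≤ 1 :=
  ⟨Finset.sum_nonneg fun j _ => hx.1 j,
    Finset.sum_le_sum_of_subset_of_nonneg (Finset.subset_univ _) fun j _ _ => hx.1 j, hx.2⟩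

lemma telescoping (p u : ℕ → ℝ) (hpu : ∀ k, p k ≤ 1 + u (k+1) - 2 * u k) (K : ℕ) :
    ∑ k ∈ Finset.Icc 1 K, (1/2:ℝ)^k * p k ≤ 1 - (1/2)^K + (1/2)^K * u (K+1) - u 1 := by
  induction K with
  | zero => simp
  | succ K ih =>
    rw [Finset.sum_Icc_succ_top (by omega)]
    have := mul_le_mul_of_nonneg_left (hpu (K+1)) (by positivity : (0:ℝ) ≤ (1/2)^(K+1))
    rw [pow_succ] at *
    linarith

/-- Expected revenue against the equal-revenue distribution is bounded. -/
lemma equal_rev {m : ℕ} (M : Finset (Entry m)) (hM : IsMenu m M) (A : Finset (Fin m))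
    (b : ℕ → Entry m) (hb : ∀ k, b k ∈ M) (hb0 : ∀ k, 0 ≤ (b k).2)
    (hmax : ∀ k, ∀ e' ∈ M, 0 ≤ e'.2 → utility (val A k) e' ≤ utility (val A k) (b k)) (K : ℕ) :
    ∑ k ∈ Finset.Icc 1 K, (1/2:ℝ)^k * (b k).2 ≤ 4 := by
  set u : ℕ → ℝ := fun k => utility (val A k) (b k) with hu
  have hu0 : ∀ k, 0 ≤ u k := by
    intro k
    have := hmax k (0,0) hM.1 le_rfl
    have h0 : utility (val A k) (0, 0) = 0 := by simp [utility]
    rw [h0] at this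
    exact this
  have h := telescoping (fun k => (b k).2) u ?_ K
  · have h2 : u (K+1) ≤ 2 ^ (K+1) := by
      simp only [hu, utility_val]
      obtain ⟨h1, h2, h3⟩ := lottery_sub (hM.2 _ (hb (K+1))) A
      have := hb0 (K+1)
      have h4 : (1:ℝ) ≤ 2^(K+1) := one_le_pow₀ (by norm_num)
      nlinarith
    have h3 : (1/2:ℝ)^K * u (K+1) ≤ (1/2)^K * 2^(K+1) :=
      mul_le_mul_of_nonneg_left h2 (by positivity)
    have h4 : (1/2:ℝ)^K * 2^(K+1) = 2 := by
      rw [pow_succ, ← mul_assoc, ← mul_pow]; norm_num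
    have h5 : (0:ℝ) < (1/2)^K := by positivity
    have := hu0 1
    linarith
  · intro k
    have h1 := hmax (k+1) (b k) (hb k) (hb0 k)
    have h2 : u (k+1) = utility (val A (k+1)) (b (k+1)) := rfl
    have h3 : u k = utility (val A k) (b k) := rfl
    rw [← h2] at h1
    rw [utility_val] at h1 h3
    obtain ⟨h4, h5, h6⟩ := lottery_sub (hM.2 _ (hb k)) A
    rw [pow_succ] at h1
    linarith

lemma sum_half (K : ℕ) : ∑ k ∈ Finset.Icc 1 K, (1/2:ℝ)^k = 1 - (1/2)^K := by
  induction K with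
  | zero => simp
  | succ K ih => rw [Finset.sum_Icc_succ_top (by omega), ih, pow_succ]; ring

lemma exp_upper {y : ℝ} (h0 : 0 ≤ y) (h1 : y ≤ 1) : Real.exp y ≤ 1 + 2 * y := by
  have := convexOn_exp.2 (Set.mem_univ 0) (Set.mem_univ 1) (sub_nonneg.2 h1) h0 (by ring)
  simp at this
  nlinarith [Real.exp_one_lt_d9]

lemma exp_lower {y : ℝ} (h0 : 0 ≤ y) (h1 : y ≤ 1) : Real.exp (-y) ≤ 1 - y / 2 := by
  have := convexOn_exp.2 (Set.mem_univ 0) (Set.mem_univ (-1)) (sub_nonneg.2 h1) h0 (by ring)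
  simp at this
  have h2 : Real.exp (-1) ≤ 1/2 := by
    rw [Real.exp_neg, inv_eq_one_div]
    exact one_div_le_one_div_of_le (by norm_num) (by linarith [Real.exp_one_gt_d9])
  nlinarith

lemma exists_levels {ι W : Type} [Fintype ι] [DecidableEq ι] [Fintype W] (K : ℕ) (hK : 1 ≤ K)
    (H : ℝ) (hKH : (2:ℝ)^K ≤ H) (g : W → ι → ℕ → ℝ)
    (hg0 : ∀ w i k, 0 ≤ g w i k) (hgH : ∀ w i, ∀ k ≤ K, g w i k ≤ H)
    (hg4 : ∀ w i, ∑ k ∈ Finset.Icc 1 K, (1/2:ℝ)^k * g w i k ≤ 4)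
    (hW : (Fintype.card W : ℝ) * Real.exp (-(4 * Fintype.card ι / H)) +
      Real.exp (-(Fintype.card ι * K / (4 * H))) < 1) :
    ∃ k : ι → ℕ, (∀ i, 1 ≤ k i ∧ k i ≤ K) ∧ (∀ w, ∑ i, g w i (k i) ≤ 20 * Fintype.card ι) ∧
      (K / 4 * Fintype.card ι : ℝ) ≤ ∑ i, (2:ℝ) ^ (k i) := by
  by_contra hcon
  push Not at hcon
  have hH : 0 < H := lt_of_lt_of_le (by positivity) hKH
  set N : ℝ := (Fintype.card ι : ℝ) with hN
  set Z : ℝ := ∑ k ∈ Finset.Icc 1 K, (1/2:ℝ)^k with hZ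
  have hZ1 : Z ≤ 1 := by rw [hZ, sum_half]; linarith [show (0:ℝ) < (1/2)^K by positivity]
  have hZ2 : 1/2 ≤ Z := by
    rw [hZ, sum_half]
    have : (1/2:ℝ)^K ≤ (1/2)^1 := pow_le_pow_of_le_one (by norm_num) (by norm_num) hK
    linarith
  set P := Fintype.piFinset (fun _ : ι => Finset.Icc 1 K) with hP
  set q : (ι → ℕ) → ℝ := fun k => ∏ i, (1/2:ℝ)^(k i) with hq
  have hsumq : ∑ k ∈ P, q k = Z ^ Fintype.card ι := by
    rw [hP, hq, Finset.sum_prod_piFinset]; simp [hZ]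
  set Φ : (ι → ℕ) → ℝ := fun k =>
    ∑ w, Real.exp (-(20 * N / H)) * ∏ i, Real.exp (g w i (k i) / H) +
      Real.exp (N * K / (4 * H)) * ∏ i, Real.exp (-(2 ^ (k i) / H)) with hΦ
  have hΦ1 : ∀ k ∈ P, 1 ≤ Φ k := by
    intro k hk
    have hk' : ∀ i, 1 ≤ k i ∧ k i ≤ K := by simpa [hP, Fintype.mem_piFinset] using hk
    by_cases h : ∀ w, ∑ i, g w i (k i) ≤ 20 * N
    · have h2 := hcon k hk' h
      have h3 : 1 ≤ Real.exp (N * K / (4 * H)) * ∏ i, Real.exp (-(2 ^ (k i) / H)) := by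
        rw [← Real.exp_sum, ← Real.exp_add, Finset.sum_neg_distrib, ← Finset.sum_div]
        apply Real.one_le_exp
        rw [show N * K / (4 * H) = (K / 4 * N) / H by field_simp, ← sub_eq_add_neg, ← sub_div]
        exact div_nonneg (by linarith) hH.le
      have h4 : 0 ≤ ∑ w, Real.exp (-(20 * N / H)) * ∏ i, Real.exp (g w i (k i) / H) := by
        positivity
      simp only [hΦ]; linarith
    · push Not at h
      obtain ⟨w, hw⟩ := h
      have h3 : 1 ≤ Real.exp (-(20 * N / H)) * ∏ i, Real.exp (g w i (k i) / H) := by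
        rw [← Real.exp_sum, ← Real.exp_add, ← Finset.sum_div]
        apply Real.one_le_exp
        rw [neg_add_eq_sub, ← sub_div]
        exact div_nonneg (by linarith) hH.le
      have h4 := Finset.single_le_sum
        (f := fun w => Real.exp (-(20 * N / H)) * ∏ i, Real.exp (g w i (k i) / H))
        (fun w _ => by positivity) (Finset.mem_univ w)
      have h5 : 0 ≤ Real.exp (N * K / (4 * H)) * ∏ i, Real.exp (-(2 ^ (k i) / H)) := by
        positivity
      simp only [hΦ]; linarith
  have key1 : Z ^ Fintype.card ι ≤ ∑ k ∈ P, q k * Φ k := by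
    rw [← hsumq]
    refine Finset.sum_le_sum fun k hk => ?_
    have : 0 ≤ q k := by simp only [hq]; positivity
    nlinarith [hΦ1 k hk]
  have hprod : ∀ f : ι → ℕ → ℝ, ∑ k ∈ P, q k * ∏ i, f i (k i) =
      ∏ i, ∑ k ∈ Finset.Icc 1 K, (1/2:ℝ)^k * f i k := by
    intro f
    rw [← Finset.sum_prod_piFinset]
    simp [hq, hP, Finset.prod_mul_distrib]
  have key2 : ∑ k ∈ P, q k * Φ k =
      ∑ w, Real.exp (-(20 * N / H)) *
        (∏ i, ∑ k ∈ Finset.Icc 1 K, (1/2:ℝ)^k * Real.exp (g w i k / H)) +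
      Real.exp (N * K / (4 * H)) *
        ∏ i : ι, ∑ k ∈ Finset.Icc 1 K, (1/2:ℝ)^k * Real.exp (-(2 ^ k / H)) := by
    rw [← hprod (fun _ k => Real.exp (-(2 ^ k / H)))]
    simp_rw [← hprod (fun i k => Real.exp (g _ i k / H))]
    simp only [hΦ, mul_add, Finset.sum_add_distrib, Finset.mul_sum]
    rw [Finset.sum_comm]
    congr 1
    · refine Finset.sum_congr rfl fun w _ => Finset.sum_congr rfl fun k _ => by ring
    · refine Finset.sum_congr rfl fun k _ => by ring
  have b1 : ∀ w i, ∑ k ∈ Finset.Icc 1 K, (1/2:ℝ)^k * Real.exp (g w i k / H) ≤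
      Z * Real.exp (16 / H) := by
    intro w i
    calc _ ≤ ∑ k ∈ Finset.Icc 1 K, ((1/2:ℝ)^k + 2 / H * ((1/2:ℝ)^k * g w i k)) := by
          refine Finset.sum_le_sum fun k hk => ?_
          have := exp_upper (div_nonneg (hg0 w i k) hH.le)
            ((div_le_one hH).2 (hgH w i k (Finset.mem_Icc.1 hk).2))
          have h2 := mul_le_mul_of_nonneg_left this (by positivity : (0:ℝ) ≤ (1/2)^k)
          refine h2.trans (le_of_eq ?_)
          ring
      _ = Z + 2 / H * ∑ k ∈ Finset.Icc 1 K, (1/2:ℝ)^k * g w i k := by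
          rw [Finset.sum_add_distrib, Finset.mul_sum]
      _ ≤ Z + 2 / H * 4 := by gcongr; exact hg4 w i
      _ ≤ Z * (16 / H + 1) := by
          have : 2 / H * 4 = 1/2 * (16 / H) := by ring
          have h16 : 0 < 16 / H := by positivity
          nlinarith
      _ ≤ _ := by gcongr; exact Real.add_one_le_exp _
  have b2 : ∑ k ∈ Finset.Icc 1 K, (1/2:ℝ)^k * Real.exp (-(2 ^ k / H)) ≤
      Z * Real.exp (-(K / (2 * H))) := by
    calc _ ≤ ∑ k ∈ Finset.Icc 1 K, ((1/2:ℝ)^k - 1 / (2 * H)) := by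
          refine Finset.sum_le_sum fun k hk => ?_
          have hk2 : (2:ℝ)^k ≤ H :=
            (pow_le_pow_right₀ (by norm_num) (Finset.mem_Icc.1 hk).2).trans hKH
          have := exp_lower (by positivity) ((div_le_one hH).2 hk2)
          have h2 := mul_le_mul_of_nonneg_left this (by positivity : (0:ℝ) ≤ (1/2)^k)
          refine h2.trans (le_of_eq ?_)
          have h3 : (1/2:ℝ)^k * 2^k = 1 := by rw [← mul_pow]; norm_num
          calc (1/2:ℝ)^k * (1 - 2^k / H / 2) = (1/2:ℝ)^k - ((1/2:ℝ)^k * 2^k) / (2 * H) := by ring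
            _ = _ := by rw [h3]
      _ = Z - K / (2 * H) := by
          rw [Finset.sum_sub_distrib]; simp [hZ]; ring
      _ ≤ Z * (-(K / (2 * H)) + 1) := by
          have : 0 ≤ K / (2 * H) := by positivity
          nlinarith
      _ ≤ _ := by gcongr; exact Real.add_one_le_exp _
  have hZp : 0 < Z ^ Fintype.card ι := by positivity
  have c1 : ∀ w, Real.exp (-(20 * N / H)) *
        (∏ i, ∑ k ∈ Finset.Icc 1 K, (1/2:ℝ)^k * Real.exp (g w i k / H)) ≤
        Z ^ Fintype.card ι * Real.exp (-(4 * N / H)) := by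
    intro w
    have : (∏ i, ∑ k ∈ Finset.Icc 1 K, (1/2:ℝ)^k * Real.exp (g w i k / H)) ≤
        ∏ i : ι, (Z * Real.exp (16 / H)) :=
      Finset.prod_le_prod (fun i _ => by positivity) (fun i _ => b1 w i)
    rw [Finset.prod_const, Finset.card_univ, mul_pow, ← Real.exp_nat_mul] at this
    refine (mul_le_mul_of_nonneg_left this (Real.exp_pos _).le).trans (le_of_eq ?_)
    rw [mul_left_comm, ← Real.exp_add]
    congr 2
    rw [← hN]; ring
  have c2 : Real.exp (N * K / (4 * H)) *
        ∏ i : ι, ∑ k ∈ Finset.Icc 1 K, (1/2:ℝ)^k * Real.exp (-(2 ^ k / H)) ≤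
        Z ^ Fintype.card ι * Real.exp (-(N * K / (4 * H))) := by
    have : (∏ i : ι, ∑ k ∈ Finset.Icc 1 K, (1/2:ℝ)^k * Real.exp (-(2 ^ k / H))) ≤
        ∏ i : ι, (Z * Real.exp (-(K / (2 * H)))) :=
      Finset.prod_le_prod (fun i _ => by positivity) (fun i _ => b2)
    rw [Finset.prod_const (Z * _), Finset.card_univ, mul_pow, ← Real.exp_nat_mul] at this
    refine (mul_le_mul_of_nonneg_left this (Real.exp_pos _).le).trans (le_of_eq ?_)
    rw [mul_left_comm, ← Real.exp_add]
    congr 2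
    rw [← hN]; field_simp; ring
  have c3 := Finset.sum_le_sum (fun w (_ : w ∈ Finset.univ) => c1 w)
  rw [Finset.sum_const, Finset.card_univ, nsmul_eq_mul] at c3
  nlinarith

/-- Gilbert-Varshamov style code. -/
lemma exists_code (s : ℕ) (hs : 1 ≤ s) : ∃ C : Finset (Fin (4*s) → Fin 4), 4 ^ s ≤ C.card ∧
    ∀ c ∈ C, ∀ c' ∈ C, c ≠ c' → (Finset.univ.filter (fun i => c i = c' i)).card < 3 * s := by
  classical
  let agr : (Fin (4*s) → Fin 4) → (Fin (4*s) → Fin 4) → ℕ :=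
    fun c c' => (Finset.univ.filter (fun i => c i = c' i)).card
  let good : Finset (Finset (Fin (4*s) → Fin 4)) := Finset.univ.filter
    (fun C => ∀ c ∈ C, ∀ c' ∈ C, c ≠ c' → agr c c' < 3 * s)
  obtain ⟨C, hC, hmax⟩ := Finset.exists_max_image good Finset.card ⟨∅, by simp [good]⟩
  have hCg : ∀ c ∈ C, ∀ c' ∈ C, c ≠ c' → agr c c' < 3 * s := (Finset.mem_filter.1 hC).2
  refine ⟨C, ?_, hCg⟩
  have hcov : ∀ x, ∃ c ∈ C, 3 * s ≤ agr c x := by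
    intro x
    by_contra hx
    push Not at hx
    have hxC : x ∉ C := by
      intro h
      have := hx x h
      simp [agr] at this
      omega
    have hgood : insert x C ∈ good := by
      refine Finset.mem_filter.2 ⟨Finset.mem_univ _, ?_⟩
      intro c hc c' hc' hne
      rcases Finset.mem_insert.1 hc with rfl | hc1 <;> rcases Finset.mem_insert.1 hc' with rfl | hc1'
      · exact absurd rfl hne
      · have := hx c' hc1'
        simpa [agr, eq_comm] using this
      · exact hx c hc1
      · exact hCg c hc1 c' hc1' hne
    have := hmax _ hgood
    rw [Finset.card_insert_of_notMem hxC] at this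
    omega
  have hball : ∀ c, (Finset.univ.filter (fun x => 3 * s ≤ agr c x)).card * 64 ^ s ≤ 4096 ^ s := by
    intro c
    have e1 : ∑ x : Fin (4*s) → Fin 4, 4 ^ agr c x = 7 ^ (4*s) := by
      have : ∀ x : Fin (4*s) → Fin 4, 4 ^ agr c x = ∏ i, (if c i = x i then 4 else 1) := by
        intro x
        rw [Finset.prod_ite]; simp [agr]
      simp_rw [this]
      rw [← Fintype.piFinset_univ,
        Finset.sum_prod_piFinset (Finset.univ) (fun i y => if c i = y then 4 else 1)]
      have h7 : ∀ a : Fin 4, ∑ y : Fin 4, (if a = y then 4 else 1) = 7 := by decide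
      simp [h7]
    calc _ = ∑ x ∈ Finset.univ.filter (fun x => 3 * s ≤ agr c x), 4 ^ (3 * s) := by
          rw [Finset.sum_const, smul_eq_mul, pow_mul]; norm_num
      _ ≤ ∑ x ∈ Finset.univ.filter (fun x => 3 * s ≤ agr c x), 4 ^ agr c x :=
          Finset.sum_le_sum fun x hx => Nat.pow_le_pow_right (by norm_num) (Finset.mem_filter.1 hx).2
      _ ≤ ∑ x : Fin (4*s) → Fin 4, 4 ^ agr c x :=
          Finset.sum_le_sum_of_subset (Finset.subset_univ _)
      _ = 2401 ^ s := by rw [e1, pow_mul]; norm_num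
      _ ≤ _ := Nat.pow_le_pow_left (by norm_num) s
  have hball' : ∀ c, (Finset.univ.filter (fun x => 3 * s ≤ agr c x)).card ≤ 64 ^ s := by
    intro c
    have h := hball c
    rw [show (4096:ℕ) = 64 * 64 by norm_num, mul_pow] at h
    exact Nat.le_of_mul_le_mul_right h (by positivity)
  have htot : 256 ^ s ≤ C.card * 64 ^ s := by
    calc 256 ^ s = (Finset.univ : Finset (Fin (4*s) → Fin 4)).card := by
          simp [pow_mul]
      _ ≤ (C.biUnion (fun c => Finset.univ.filter (fun x => 3 * s ≤ agr c x))).card := by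
          apply Finset.card_le_card
          intro x _
          obtain ⟨c, hc, h⟩ := hcov x
          exact Finset.mem_biUnion.2 ⟨c, hc, by simpa using h⟩
      _ ≤ C.card * 64 ^ s := Finset.card_biUnion_le_card_mul _ _ _ fun c _ => hball' c
  rw [show (256:ℕ) = 4 * 64 by norm_num, mul_pow] at htot
  exact Nat.le_of_mul_le_mul_right htot (by positivity)

lemma exists_family (m : ℕ) (hm : 400 < m) : ∃ (ι : Type) (_ : Fintype ι) (_ : DecidableEq ι)
    (A : ι → Finset (Fin m)) (a : ℕ), 0 < a ∧ (∀ i, (A i).card = a) ∧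
      (∀ i j, i ≠ j → 4 * (A i ∩ A j).card ≤ 3 * a) ∧
      4 * (2:ℝ) ^ ((m:ℝ) / 200) ≤ Fintype.card ι := by
  classical
  set s := m / 16 with hs
  have hs1 : 1 ≤ s := by omega
  obtain ⟨C, hC, hd⟩ := exists_code s hs1
  have hcard : Fintype.card (Fin (4*s) × Fin 4) ≤ Fintype.card (Fin m) := by
    simp; omega
  obtain ⟨f⟩ := Function.Embedding.nonempty_of_card_le hcard
  have hinj : ∀ c : Fin (4*s) → Fin 4, Function.Injective (fun i => f (i, c i)) := by
    intro c i j h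
    exact (Prod.ext_iff.1 (f.injective h)).1
  refine ⟨C, inferInstance, inferInstance, fun c => Finset.univ.image (fun i => f (i, c.1 i)),
    4 * s, by omega, ?_, ?_, ?_⟩
  · intro c
    rw [Finset.card_image_of_injective _ (hinj c.1)]; simp
  · intro c c' hne
    have h1 := hd c.1 c.2 c'.1 c'.2 (fun h => hne (Subtype.ext h))
    have h2 : (Finset.univ.image (fun i => f (i, c.1 i)) ∩
        Finset.univ.image (fun i => f (i, c'.1 i))) ⊆
        (Finset.univ.filter (fun i => c.1 i = c'.1 i)).image (fun i => f (i, c.1 i)) := by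
      intro x hx
      simp only [Finset.mem_inter, Finset.mem_image, Finset.mem_univ, true_and] at hx
      obtain ⟨⟨i, rfl⟩, j, hj⟩ := hx
      have := Prod.ext_iff.1 (f.injective hj)
      simp only at this
      obtain ⟨rfl, h⟩ := this
      exact Finset.mem_image.2 ⟨j, by simp [h], rfl⟩
    have h3 := (Finset.card_le_card h2).trans Finset.card_image_le
    simp only at *
    omega
  · have h1 : ((4 ^ s : ℕ) : ℝ) ≤ Fintype.card C := by
      rw [Fintype.card_coe]; exact_mod_cast hC
    refine le_trans ?_ h1
    have h2 : ((4 ^ s : ℕ) : ℝ) = (2:ℝ) ^ (2 * s : ℝ) := by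
      rw [Real.rpow_mul (by norm_num)]; norm_num
    rw [h2, show (4:ℝ) = (2:ℝ) ^ (2:ℝ) by norm_num, ← Real.rpow_add (by norm_num)]
    apply Real.rpow_le_rpow_of_exponent_le (by norm_num)
    have h3 : m ≤ 16 * s + 15 := by omega
    have h4 : (m:ℝ) ≤ 16 * s + 15 := by exact_mod_cast h3
    have h5 : (400:ℝ) < m := by exact_mod_cast hm
    linarith

/-- Uniform distribution over the points `v i`. -/
noncomputable def unif {m : ℕ} {ι : Type} [Fintype ι] (v : ι → Fin m → ℝ) :
    Measure (Fin m → ℝ) :=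
  ∑ i, ((Fintype.card ι : ENNReal))⁻¹ • Measure.dirac (v i)

lemma unif_apply_one {m : ℕ} {ι : Type} [Fintype ι] [Nonempty ι] (v : ι → Fin m → ℝ)
    (S : Set (Fin m → ℝ)) (hS : MeasurableSet S) (h : ∀ i, v i ∈ S) : unif v S = 1 := by
  have : ∀ i, Measure.dirac (v i) S = 1 := fun i => by
    rw [Measure.dirac_apply' _ hS]; simp [h i]
  simp [unif, this]
  exact ENNReal.mul_inv_cancel (by simp) (by simp)

lemma revSel_unif {m : ℕ} {ι : Type} [Fintype ι] (v : ι → Fin m → ℝ)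
    (s : (Fin m → ℝ) → Entry m) :
    revSel (unif v) s = (∑ i, (s (v i)).2) / Fintype.card ι := by
  unfold revSel unif
  rw [integral_finsetSum_measure]
  · simp [integral_smul_measure, ← Finset.mul_sum]
    rw [div_eq_inv_mul]
  · intro i _
    by_cases hi : Nonempty ι
    · refine Integrable.smul_measure ?_ (by simp)
      exact integrable_dirac (by simp [enorm_lt_top])
    · exact absurd ⟨i⟩ hi

lemma price_le {m : ℕ} (M : Finset (Entry m)) (hM : IsMenu m M) (v : Fin m → ℝ) (H : ℝ)
    (hH : 0 ≤ H) (hv : ∀ j, v j ≤ H) (e : Entry m) (he : e ∈ M)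
    (h0 : utility v (0, 0) ≤ utility v e) : e.2 ≤ H := by
  have h1 : 0 ≤ utility v e := by simpa [utility] using h0
  have h2 : ∑ j, v j * e.1 j ≤ ∑ j, H * e.1 j :=
    Finset.sum_le_sum fun j _ => mul_le_mul_of_nonneg_right (hv j) ((hM.2 e he).1 j)
  rw [← Finset.mul_sum] at h2
  have h3 := mul_le_mul_of_nonneg_left (hM.2 e he).2 hH
  unfold utility at h1
  linarith

lemma revSel_le {m : ℕ} {ι : Type} [Fintype ι] [Nonempty ι] (v : ι → Fin m → ℝ) (H : ℝ)
    (hH : 0 ≤ H)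
    (hv : ∀ i j, v i j ≤ H) (M : Finset (Entry m)) (hM : IsMenu m M) (s) (hs : IsSelection M s) :
    revSel (unif v) s ≤ H := by
  rw [revSel_unif, div_le_iff₀ (by exact_mod_cast Fintype.card_pos)]
  calc ∑ i, (s (v i)).2 ≤ ∑ i : ι, H := Finset.sum_le_sum fun i _ =>
        price_le M hM (v i) H hH (hv i) _ (hs _).1 ((hs _).2 _ hM.1)
    _ = _ := by simp [mul_comm]

lemma revSel_le_OPT {m : ℕ} {ι : Type} [Fintype ι] [Nonempty ι] (v : ι → Fin m → ℝ) (H : ℝ)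
    (hH : 0 ≤ H)
    (hv : ∀ i j, v i j ≤ H) (M : Finset (Entry m)) (hM : IsMenu m M) (s) (hs : IsSelection M s) :
    revSel (unif v) s ≤ OPT (unif v) := by
  have h1 : revSel (unif v) s ≤ Rev (unif v) M := by
    refine le_csSup ⟨H, ?_⟩ ⟨s, hs, rfl⟩
    rintro r ⟨s', hs', rfl⟩
    exact revSel_le v H hH hv M hM s' hs'
  refine h1.trans (le_csSup ⟨H, ?_⟩ ⟨M, hM, rfl⟩)
  rintro r ⟨M', hM', rfl⟩
  refine Real.sSup_le ?_ hH
  rintro r ⟨s', hs', rfl⟩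
  exact revSel_le v H hH hv M' hM' s' hs'

/-- The optimal menu extracts a constant fraction of the average scale. -/
lemma OPT_lower {m : ℕ} {ι : Type} [Fintype ι] [Nonempty ι] [DecidableEq ι]
    (A : ι → Finset (Fin m)) (a : ℕ) (ha : 0 < a) (hA : ∀ i, (A i).card = a)
    (hAA : ∀ i j, i ≠ j → 4 * (A i ∩ A j).card ≤ 3 * a) (k : ι → ℕ) (hk : ∀ i, 1 ≤ k i)
    (H : ℝ) (hH : 0 ≤ H) (hv : ∀ i j, val (A i) (k i) j ≤ H) :
    (∑ i, (2:ℝ) ^ (k i)) / 8 / Fintype.card ι ≤ OPT (unif fun i => val (A i) (k i)) := by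
  classical
  let x : ι → Fin m → ℝ := fun i j => if j ∈ A i then (1:ℝ) / a else 0
  let E : ι → Entry m := fun i => (x i, ((2:ℝ) ^ (k i) - 1) / 4)
  let M : Finset (Entry m) := insert (0, 0) (Finset.univ.image E)
  have ha' : (0:ℝ) < a := by exact_mod_cast ha
  have hxs : ∀ i, ∑ j, x i j = 1 := by
    intro i
    simp only [x, Finset.sum_ite_mem, Finset.univ_inter, Finset.sum_const, hA i, nsmul_eq_mul]
    field_simp
  have hxA : ∀ i i', ∑ j ∈ A i', x i j = ((A i' ∩ A i).card : ℝ) / a := by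
    intro i i'
    simp only [x, Finset.sum_ite_mem, Finset.sum_const, nsmul_eq_mul]
    ring
  have h2k : ∀ i, (2:ℝ) ≤ 2 ^ (k i) := by
    intro i
    calc (2:ℝ) = 2 ^ 1 := by norm_num
      _ ≤ _ := pow_le_pow_right₀ (by norm_num) (hk i)
  have hM : IsMenu m M := by
    refine ⟨Finset.mem_insert_self _ _, ?_⟩
    intro e he
    rcases Finset.mem_insert.1 he with rfl | he
    · exact ⟨fun j => le_rfl, by simp⟩
    · obtain ⟨i, _, rfl⟩ := Finset.mem_image.1 he
      refine ⟨fun j => ?_, (hxs i).le⟩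
      simp only [E, x]; split_ifs <;> positivity
  have hpos : ∀ e ∈ M, 0 ≤ e.2 := by
    intro e he
    rcases Finset.mem_insert.1 he with rfl | he
    · exact le_rfl
    · obtain ⟨i, _, rfl⟩ := Finset.mem_image.1 he
      have := h2k i
      simp only [E]; linarith
  choose b hb hb0 hbm hbp using fun v => exists_best M hM v
  have hsel : IsSelection M b := fun v => ⟨hb v, fun e he => hbm v e he (hpos e he)⟩
  refine le_trans ?_ (revSel_le_OPT _ H hH hv M hM b hsel)
  rw [revSel_unif, Finset.sum_div]
  gcongr with i _
  have hEi : E i ∈ M := Finset.mem_insert_of_mem (Finset.mem_image_of_mem _ (Finset.mem_univ i))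
  have hmax := hbp (val (A i) (k i)) (E i) hEi ?_
  · refine le_trans ?_ hmax
    have := h2k i
    simp only [E]; linarith
  · have hown : utility (val (A i) (k i)) (E i) = 2 ^ (k i) - (2 ^ (k i) - 1) / 4 := by
      rw [utility_val]
      simp only [E, hxs, hxA, Finset.inter_self, hA]
      field_simp
      ring
    rw [hown]
    have := h2k i
    intro e he
    rcases Finset.mem_insert.1 he with rfl | he
    · have : utility (val (A i) (k i)) (0, 0) = 0 := by simp [utility]
      rw [this]; linarith
    · obtain ⟨j, _, rfl⟩ := Finset.mem_image.1 he
      by_cases hij : i = j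
      · subst hij; rw [hown]
      · rw [utility_val]
        simp only [E, hxs, hxA]
        have h1 : ((A i ∩ A j).card : ℝ) / a ≤ 3 / 4 := by
          rw [div_le_div_iff₀ ha' (by norm_num)]
          have := hAA i j hij
          have h' : (4 * (A i ∩ A j).card : ℝ) ≤ 3 * a := by exact_mod_cast this
          linarith
        have := h2k j
        nlinarith

lemma card_strings (T : ℕ) :
    Fintype.card (Σ j : Fin (T+1), (Fin j → Bool)) ≤ 2 ^ (T+1) := by
  rw [Fintype.card_sigma]
  simp only [Fintype.card_fun, Fintype.card_bool, Fintype.card_fin]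
  rw [Fin.sum_univ_eq_sum_range (fun j => 2 ^ j) (T+1)]
  exact (Nat.geomSum_lt le_rfl (by simp)).le

/-- **Theorem 4 (main lower bound).** For every auction representation language `L`
(a map from finite binary strings to menus) over `m` items and every `2 ≤ H < 2^(m/400)`,
there is a finitely supported distribution `D` on `[1, H]^m` such that every menu of
`L`-complexity at most `2^(m/400)` extracts at most an `O(1/log₂ H)` fraction of the optimal
revenue. -/
theorem complexity_lower_bound :
    ∃ c : ℝ, 0 < c ∧
      ∀ (m : ℕ), 1 ≤ m →
        ∀ L : List Bool → Finset (Entry m), (∀ w, IsMenu m (L w)) →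
          ∀ H : ℝ, 2 ≤ H → H < 2 ^ ((m : ℝ) / 400) →
            ∃ D : Measure (Fin m → ℝ), IsProbabilityMeasure D ∧
              (∃ S : Finset (Fin m → ℝ),
                (↑S : Set (Fin m → ℝ)) ⊆ {v | ∀ j, v j ∈ Set.Icc (1 : ℝ) H} ∧
                D ↑S = 1) ∧
              ∀ M : Finset (Entry m),
                (∃ w : List Bool, L w = M ∧ (w.length : ℝ) ≤ 2 ^ ((m : ℝ) / 400)) →
                Rev D M ≤ c * OPT D / Real.logb 2 H := by
  refine ⟨1280, by norm_num, ?_⟩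
  intro m _ L hL H hH2 hHm
  classical
  set B : ℝ := 2 ^ ((m : ℝ) / 400) with hB
  have hH0 : 0 < H := by linarith
  have hB2 : 2 < B := by linarith
  have hm : 400 < m := by
    by_contra h
    push Not at h
    have h1 : (m:ℝ) / 400 ≤ 1 := by
      rw [div_le_one (by norm_num)]; exact_mod_cast h
    have := Real.rpow_le_rpow_of_exponent_le (by norm_num : (1:ℝ) ≤ 2) h1
    rw [Real.rpow_one] at this
    linarith
  obtain ⟨ι, _, _, A, a, ha, hA, hAA, hN⟩ := exists_family m hm
  have hBB : (2:ℝ) ^ ((m:ℝ) / 200) = B * B := by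
    rw [hB, ← Real.rpow_add (by norm_num)]; congr 1; ring
  rw [hBB] at hN
  have hNpos : (0:ℝ) < Fintype.card ι := by nlinarith
  have : Nonempty ι := Fintype.card_pos_iff.1 (by exact_mod_cast hNpos)
  obtain ⟨K, hK1, hK2⟩ := exists_nat_pow_near (by linarith : (1:ℝ) ≤ H) (by norm_num : (1:ℝ) < 2)
  have hK : 1 ≤ K := by
    by_contra h
    have : K = 0 := by omega
    subst this
    norm_num at hK2
    linarith
  choose b hb hb0 hbm hbp using fun w v => exists_best (L w) (hL w) v
  let T := Nat.floor B
  let str : (Σ j : Fin (T+1), (Fin j → Bool)) → List Bool := fun w => List.ofFn w.2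
  have hT : (T:ℝ) ≤ B := Nat.floor_le (by linarith)
  have hvH : ∀ (S : Finset (Fin m)) (k : ℕ), k ≤ K → ∀ j, val S k j ≤ H := by
    intro S k hk j
    unfold val
    split_ifs
    · exact (pow_le_pow_right₀ (by norm_num) hk).trans hK1
    · linarith
  obtain ⟨k, hkK, hg, hlow⟩ := exists_levels K hK H hK1
    (fun w i k => (b (str w) (val (A i) k)).2) (fun w i k => hb0 _ _)
    (fun w i k hk => price_le (L (str w)) (hL _) (val (A i) k) H hH0.le (hvH _ _ hk) _ (hb _ _)
      (hbm _ _ _ (hL _).1 le_rfl))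
    (fun w i => equal_rev (L (str w)) (hL _) (A i) _ (fun k => hb _ _) (fun k => hb0 _ _)
      (fun k => hbm _ _) K) (by
      have hNH : 4 * B ≤ Fintype.card ι / H := by
        rw [le_div_iff₀ hH0]; nlinarith
      have hW : (Fintype.card (Σ j : Fin (T+1), (Fin j → Bool)) : ℝ) ≤ Real.exp (B + 1) := by
        calc (Fintype.card (Σ j : Fin (T+1), (Fin j → Bool)) : ℝ) ≤ (2:ℝ) ^ (T+1) := by
              exact_mod_cast card_strings T
          _ ≤ (Real.exp 1) ^ (T+1) := by
              gcongr; linarith [Real.exp_one_gt_d9]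
          _ = Real.exp ((T+1 : ℕ) * 1) := (Real.exp_nat_mul _ _).symm
          _ ≤ _ := by
              apply Real.exp_le_exp.2; push_cast; linarith
      have he : Real.exp (-1) < 1/2 := by
        rw [Real.exp_neg, inv_eq_one_div]
        exact one_div_lt_one_div_of_lt (by norm_num) (by linarith [Real.exp_one_gt_d9])
      have t1 := mul_le_mul_of_nonneg_right hW (Real.exp_pos (-(4 * Fintype.card ι / H))).le
      rw [← Real.exp_add] at t1
      have t2 : Real.exp (B + 1 + -(4 * Fintype.card ι / H)) ≤ Real.exp (-1) := by
        apply Real.exp_le_exp.2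
        rw [mul_div_assoc]; linarith
      have t3 : Real.exp (-(Fintype.card ι * K / (4 * H))) ≤ Real.exp (-1) := by
        apply Real.exp_le_exp.2
        have hK' : (1:ℝ) ≤ K := by exact_mod_cast hK
        have : (Fintype.card ι * K / (4 * H) : ℝ) = (Fintype.card ι / H) * K / 4 := by
          field_simp
        rw [this]
        nlinarith
      linarith)
  refine ⟨unif (fun i => val (A i) (k i)),
    ⟨unif_apply_one _ _ MeasurableSet.univ fun i => Set.mem_univ _⟩,
    ⟨Finset.univ.image (fun i => val (A i) (k i)), ?_,
      unif_apply_one _ _ (Finset.measurableSet _) (by intro i; simp)⟩, ?_⟩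
  · intro v hv
    simp only [Finset.coe_image, Finset.coe_univ, Set.image_univ, Set.mem_range] at hv
    obtain ⟨i, rfl⟩ := hv
    intro j
    refine ⟨?_, hvH _ _ (hkK i).2 j⟩
    unfold val
    split_ifs
    · exact one_le_pow₀ (by norm_num)
    · exact le_rfl
  · rintro M ⟨w, rfl, hw⟩
    have hOPT := OPT_lower A a ha hA hAA k (fun i => (hkK i).1) H hH0.le
      (fun i => hvH _ _ (hkK i).2)
    have hOPT2 : (K:ℝ) / 32 ≤ OPT (unif fun i => val (A i) (k i)) := by
      refine le_trans ?_ hOPT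
      rw [le_div_iff₀ hNpos]
      linarith
    have hlog : Real.logb 2 H ≤ 2 * K := by
      have : Real.logb 2 H ≤ K + 1 := by
        rw [Real.logb_le_iff_le_rpow (by norm_num) hH0]
        exact_mod_cast hK2.le
      have hK' : (1:ℝ) ≤ K := by exact_mod_cast hK
      linarith
    have hlog0 : 0 < Real.logb 2 H := Real.logb_pos (by norm_num) (by linarith)
    have hRev : Rev (unif fun i => val (A i) (k i)) (L w) ≤ 20 := by
      refine Real.sSup_le ?_ (by norm_num)
      rintro r ⟨s, hs, rfl⟩
      rw [revSel_unif, div_le_iff₀ hNpos]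
      have hwT : w.length < T + 1 := Nat.lt_succ_of_le (Nat.le_floor hw)
      have hg' := hg ⟨⟨w.length, hwT⟩, fun i => w.get i⟩
      have hstr : str ⟨⟨w.length, hwT⟩, fun i => w.get i⟩ = w := List.ofFn_get w
      rw [hstr] at hg'
      refine le_trans (Finset.sum_le_sum fun i _ => ?_) hg'
      exact hbp w _ _ (hs _).1 (hs _).2
    rw [le_div_iff₀ hlog0]
    nlinarith
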